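/- (Lascoux, symmetric square) In ℚ[x_1,…,x_n] one has the identity 2^{binomial(n,2)} · ∏_{1 ≤ i ≤ j ≤ n} (1 + x_i + x_j) = ∑_{μ ⊆ δ_n} d_{δ_n,μ} · 2^{|μ|} · s_μ(x_1,…,x_n), where the sum is over all partitions μ contained in the staircase δ_n = (n, n−1, …, 1). -/

import Mathlib

open MvPolynomial

/-- Complete homogeneous symmetric polynomial with integer index: `0` for negative index. -/
noncomputable def hInt (n : ℕ) (m : ℤ) : MvPolynomial (Fin n) ℚ :=
  if 0 ≤ m then hsymm (Fin n) ℚ m.toNat else 0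

/-- Schur polynomial via the Jacobi–Trudi determinant. -/
noncomputable def schur (n : ℕ) (lam : Fin n → ℕ) : MvPolynomial (Fin n) ℚ :=
  (Matrix.of fun i j : Fin n => hInt n ((lam i : ℤ) - (i : ℤ) + (j : ℤ))).det

/-- The binomial determinant `d_{λ,μ}` (partitions padded to length `n`,
`0`-indexed version of `det (C(λ_i + n − i, μ_j + n − j))_{1 ≤ i,j ≤ n}`). -/
def binomDet (n : ℕ) (lam mu : Fin n → ℕ) : ℤ :=
  (Matrix.of fun i j : Fin n =>
    ((lam i + (n - 1 - (i : ℕ))).choose (mu j + (n - 1 - (j : ℕ))) : ℤ)).det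

/-- The staircase partition `δ_n = (n, n−1, …, 1)`, with exactly `n` parts. -/
def staircaseFull (n : ℕ) : Fin n → ℕ := fun i => n - (i : ℕ)

/-- The Cauchy–Binet formula. -/
theorem Matrix.det_mul_eq_sum_strictMono {R α : Type*} [CommRing R] [Fintype α] [LinearOrder α]
    {n : ℕ} (A : Matrix (Fin n) α R) (B : Matrix α (Fin n) R)
    [DecidablePred fun f : Fin n → α => StrictMono f] :
    (A * B).det = ∑ f : Fin n → α with StrictMono f,
      (A.submatrix id f).det * (B.submatrix f id).det := by
  classical
  have hexp : (A * B).det =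
      ∑ f : Fin n → α, (∏ i, A i (f i)) * (B.submatrix f id).det := by
    have h1 : (A * B) = fun i => ∑ k, A i k • B k := by
      ext i j
      simp [Matrix.mul_apply, Finset.sum_apply]
    change Matrix.detRowAlternating.toMultilinearMap (A * B) = _
    rw [h1, MultilinearMap.map_sum]
    refine Finset.sum_congr rfl fun f _ => ?_
    rw [MultilinearMap.map_smul_univ]
    rfl
  have hinj : ∑ f : Fin n → α with Function.Injective f,
      (∏ i, A i (f i)) * (B.submatrix f id).det =
      ∑ f : Fin n → α, (∏ i, A i (f i)) * (B.submatrix f id).det := by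
    refine Finset.sum_filter_of_ne fun f _ hf => ?_
    by_contra h
    simp only [Function.Injective, not_forall] at h
    obtain ⟨i, j, hij, hne⟩ := h
    refine hf ?_
    rw [Matrix.det_zero_of_row_eq hne (by ext k; simp [hij]), mul_zero]
  have hbij : ∑ p ∈ (Finset.univ.filter fun f : Fin n → α => StrictMono f) ×ˢ
        (Finset.univ : Finset (Equiv.Perm (Fin n))),
        (∏ i, A i (p.1 (p.2 i))) * (B.submatrix (p.1 ∘ p.2) id).det =
      ∑ f : Fin n → α with Function.Injective f,
        (∏ i, A i (f i)) * (B.submatrix f id).det := by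
    refine Finset.sum_bij (fun p _ => p.1 ∘ p.2) ?_ ?_ ?_ ?_
    · intro p hp
      simp only [Finset.mem_product, Finset.mem_filter, Finset.mem_univ, true_and, and_true] at hp ⊢
      exact hp.injective.comp p.2.injective
    · rintro ⟨f, σ⟩ hp ⟨g, τ⟩ hq h
      simp only [Finset.mem_product, Finset.mem_filter, Finset.mem_univ, true_and, and_true]
        at hp hq h
      have hf : (f ∘ σ) ∘ σ.symm = f := by ext; simp
      have hg : (g ∘ τ) ∘ τ.symm = g := by ext; simp
      have hfg : f = g := by
        rw [← hf, ← hg, h]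
        refine Tuple.unique_monotone ?_ ?_
        · rw [← h, hf]; exact hp.monotone
        · rw [hg]; exact hq.monotone
      subst hfg
      refine Prod.ext rfl (Equiv.ext fun i => hp.injective (congrFun h i))
    · intro f hf
      simp only [Finset.mem_filter, Finset.mem_univ, true_and] at hf
      refine ⟨(f ∘ Tuple.sort f, (Tuple.sort f).symm), ?_, ?_⟩
      · simp only [Finset.mem_product, Finset.mem_filter, Finset.mem_univ, true_and, and_true]
        exact (Tuple.monotone_sort f).strictMono_of_injective
          (hf.comp (Tuple.sort f).injective)
      · ext; simp
    · intro p _; rfl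
  rw [hexp, ← hinj, ← hbij, Finset.sum_product]
  refine Finset.sum_congr rfl fun f _ => ?_
  rw [← Matrix.det_transpose (A.submatrix id f), Matrix.det_apply', Finset.sum_mul]
  refine Finset.sum_congr rfl fun σ _ => ?_
  have := Matrix.det_permute σ (B.submatrix f id)
  rw [Matrix.submatrix_submatrix] at this
  rw [Function.id_comp] at this
  rw [this]
  simp
  ring

theorem det_pow_rev_eq_prod_sub {R : Type*} [CommRing R] {n : ℕ} (v : Fin n → R) :
    (Matrix.of fun i k : Fin n => v k ^ (n - 1 - (i : ℕ))).det =
      ∏ i, ∏ j ∈ Finset.Ioi i, (v i - v j) := by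
  rw [← Matrix.det_transpose]
  have h := Matrix.det_projVandermonde (fun _ => 1) v
  simp only [one_mul] at h
  rw [← h]
  congr 1
  ext i k
  simp [Matrix.projVandermonde_apply, Fin.val_rev]
  congr 1
  omega

theorem mk_hsymm_eq_prod (σ R : Type*) [Fintype σ] [DecidableEq σ] [CommRing R] :
    PowerSeries.mk (hsymm σ R) = ∏ l : σ, PowerSeries.mk fun m => (X l : MvPolynomial σ R) ^ m := by
  ext1 m
  rw [PowerSeries.coeff_prod, PowerSeries.coeff_mk, hsymm]
  simp only [PowerSeries.coeff_mk]
  refine Finset.sum_bij' (fun s _ => s.1.toFinsupp) (fun f hf => ⟨Finsupp.toMultiset f, ?_⟩)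
    ?_ ?_ ?_ ?_ ?_
  · simp [Finset.mem_finsuppAntidiag] at hf
    rw [Finsupp.card_toMultiset, Finsupp.sum_fintype]
    · simpa using hf
    · simp
  · intro s _
    rw [Finset.mem_finsuppAntidiag]
    refine ⟨?_, Finset.subset_univ _⟩
    change ∑ a, Multiset.count a (s : Multiset σ) = m
    rw [Multiset.sum_count_eq_card (fun _ _ => Finset.mem_univ _)]
    exact s.2
  · intro f _; exact Finset.mem_univ _
  · intro s _; exact Subtype.ext (by simp)
  · intro f _; simp
  · intro s _
    rw [Finset.prod_multiset_map_count]
    simp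
    refine Finset.prod_subset (Finset.subset_univ _) ?_
    intro x _ hx
    rw [Multiset.count_eq_zero_of_notMem (by simpa using hx), pow_zero]

theorem mk_pow_mul_one_sub {R : Type*} [CommRing R] (x : R) :
    (PowerSeries.mk fun m => x ^ m) * (1 - PowerSeries.C x * PowerSeries.X) = 1 := by
  ext1 m
  cases m <;> simp [mul_sub, ← mul_assoc, PowerSeries.coeff_succ_mul_X, PowerSeries.coeff_one,
    pow_succ]

theorem exists_X_pow_eq_sum_hInt (n : ℕ) (k : Fin n) : ∃ q : ℕ → MvPolynomial (Fin n) ℚ,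
   ∀ m : ℕ, (X k : MvPolynomial (Fin n) ℚ) ^ m =
     ∑ j : Fin n, hInt n ((m : ℤ) - (n - 1 : ℕ) + (j : ℤ)) * q (n - 1 - j) := by
  let Q : Polynomial (MvPolynomial (Fin n) ℚ) :=
    ∏ l ∈ Finset.univ.erase k, (1 - Polynomial.C (X l) * Polynomial.X)
  have hQ : Q.natDegree ≤ n - 1 := by
    refine (Polynomial.natDegree_prod_le _ _).trans ?_
    refine (Finset.sum_le_card_nsmul _ _ 1 fun l _ => ?_).trans (by simp)
    compute_degree
  have hcoe : (Q : PowerSeries (MvPolynomial (Fin n) ℚ)) =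
      ∏ l ∈ Finset.univ.erase k, (1 - PowerSeries.C (X l) * PowerSeries.X) := by
    rw [← Polynomial.coeToPowerSeries.ringHom_apply, map_prod]
    simp
  have hmul : (Q : PowerSeries (MvPolynomial (Fin n) ℚ)) * PowerSeries.mk (hsymm (Fin n) ℚ) =
      PowerSeries.mk fun m => (X k : MvPolynomial (Fin n) ℚ) ^ m := by
    rw [mk_hsymm_eq_prod, hcoe, ← Finset.mul_prod_erase _ _ (Finset.mem_univ k), mul_left_comm,
      ← Finset.prod_mul_distrib]
    rw [Finset.prod_eq_one, mul_one]
    intro l _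
    rw [mul_comm, mk_pow_mul_one_sub]
  refine ⟨Q.coeff, fun m => ?_⟩
  have hm := congrArg (PowerSeries.coeff m) hmul
  rw [PowerSeries.coeff_mk, PowerSeries.coeff_mul,
    Finset.Nat.sum_antidiagonal_eq_sum_range_succ
      (fun a b => PowerSeries.coeff a (Q : PowerSeries (MvPolynomial (Fin n) ℚ)) *
        PowerSeries.coeff b (PowerSeries.mk (hsymm (Fin n) ℚ)))] at hm
  simp only [Polynomial.coeff_coe, PowerSeries.coeff_mk] at hm
  have hn : 0 < n := k.pos
  have hrev : ∑ j : Fin n, hInt n ((m : ℤ) - (n - 1 : ℕ) + (j : ℤ)) * Q.coeff (n - 1 - j) =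
      ∑ b ∈ Finset.range n, hInt n ((m : ℤ) - b) * Q.coeff b := by
    rw [Finset.sum_range, ← Equiv.sum_comp Fin.revPerm]
    refine Finset.sum_congr rfl fun j _ => ?_
    have hj := j.isLt
    simp only [Fin.revPerm_apply, Fin.val_rev]
    congr 2 <;> omega
  have hpos : ∑ b ∈ Finset.range m.succ, Q.coeff b * hsymm (Fin n) ℚ (m - b) =
      ∑ b ∈ Finset.range m.succ, hInt n ((m : ℤ) - b) * Q.coeff b := by
    refine Finset.sum_congr rfl fun b hb => ?_
    rw [Finset.mem_range] at hb
    rw [hInt, if_pos (by omega), mul_comm]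
    congr 2
    omega
  rw [hrev, ← hm, hpos,
    Finset.sum_subset (Finset.range_subset_range.2 (by omega : m + 1 ≤ m + 1 + n)),
    Finset.sum_subset (Finset.range_subset_range.2 (by omega : n ≤ m + 1 + n))]
  · intro b _ hb
    rw [Finset.mem_range] at hb
    rw [Polynomial.coeff_eq_zero_of_natDegree_lt (by omega), mul_zero]
  · intro b _ hb
    rw [Finset.mem_range] at hb
    rw [hInt, if_neg (by omega), zero_mul]

theorem schur_zero (n : ℕ) : schur n 0 = 1 := by
  rw [schur, Matrix.det_of_isUpperTriangular]
  · simp [hInt]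
  · intro i j hij
    have : (j : ℕ) < i := hij
    simp only [Matrix.of_apply, hInt, Pi.zero_apply]
    rw [if_neg (by omega)]

/-- The Jacobi–Trudi identity, in bialternant form. -/
theorem det_X_pow_eq_schur_mul (n : ℕ) (lam : Fin n → ℕ) :
    (Matrix.of fun i k : Fin n =>
      (X k : MvPolynomial (Fin n) ℚ) ^ (lam i + (n - 1 - (i : ℕ)))).det =
      schur n lam * ∏ i : Fin n, ∏ j ∈ Finset.Ioi i, (X i - X j) := by
  choose q hq using exists_X_pow_eq_sum_hInt n
  let E : Matrix (Fin n) (Fin n) (MvPolynomial (Fin n) ℚ) :=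
    Matrix.of fun j k => q k (n - 1 - j)
  have key (lam : Fin n → ℕ) : (Matrix.of fun i k : Fin n =>
      (X k : MvPolynomial (Fin n) ℚ) ^ (lam i + (n - 1 - (i : ℕ)))).det =
      schur n lam * E.det := by
    rw [schur, ← Matrix.det_mul]
    congr 1
    ext1 i k
    rw [Matrix.of_apply, hq, Matrix.mul_apply]
    refine Finset.sum_congr rfl fun j _ => ?_
    simp only [Matrix.of_apply, E]
    congr 2
    omega
  have h0 := key 0
  rw [schur_zero, one_mul] at h0
  rw [key, ← h0, ← det_pow_rev_eq_prod_sub]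
  simp

theorem StrictAnti.add_val_le {n : ℕ} {g : Fin n → ℕ} (hg : StrictAnti g) {i j : Fin n}
    (hij : i ≤ j) :
    g j + j ≤ g i + i := by
  obtain ⟨d, hd⟩ := Nat.exists_eq_add_of_le (Fin.le_def.1 hij)
  induction d generalizing j with
  | zero => rw [Fin.ext (by omega : (j : ℕ) = i)]
  | succ d ih =>
    have hlt : (i : ℕ) + d < n := by omega
    have h1 := @ih ⟨i + d, hlt⟩ (Fin.le_def.2 (by simp)) rfl
    have h2 : g j < g ⟨i + d, hlt⟩ := hg (Fin.lt_def.2 (by simp; omega))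
    simp only at h1
    omega

theorem binomDet_eq_zero_of_not_le {n : ℕ} {lam mu : Fin n → ℕ} (hlam : Antitone lam)
    (hmu : Antitone mu) (h : ¬ mu ≤ lam) : binomDet n lam mu = 0 := by
  simp only [Pi.le_def, not_forall, not_le] at h
  obtain ⟨k, hk⟩ := h
  rw [binomDet, Matrix.det_apply]
  refine Finset.sum_eq_zero fun σ _ => ?_
  have : ∃ j ≤ k, k ≤ σ j := by
    by_contra! hcon
    have hcard : (Finset.Iic k).card ≤ (Finset.Iio k).card :=
      Finset.card_le_card_of_injOn σ (fun j hj => by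
        simpa using hcon j (by simpa using hj)) σ.injective.injOn
    simp at hcard
  obtain ⟨j, hj, hkj⟩ := this
  rw [Finset.prod_eq_zero (Finset.mem_univ j), smul_zero]
  rw [Matrix.of_apply, Nat.choose_eq_zero_of_lt, Nat.cast_zero]
  have h1 := hlam hkj
  have h2 := hmu hj
  have h3 := Fin.le_def.1 hj
  have h4 := Fin.le_def.1 hkj
  omega

theorem sum_sub_val_eq_choose_two (n : ℕ) : ∑ i : Fin n, (n - 1 - (i : ℕ)) = n.choose 2 := by
  rw [Fin.sum_univ_eq_sum_range (fun i => n - 1 - i), Finset.sum_range_reflect (fun i => i) n,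
    Finset.sum_range_id, Nat.choose_two_right]

theorem det_odd_powers (n : ℕ) :
    (Matrix.of fun i k : Fin n => (1 + 2 * X k : MvPolynomial (Fin n) ℚ) ^
      (staircaseFull n i + (n - 1 - (i : ℕ)))).det =
    4 ^ n.choose 2 * (∏ i : Fin n, ∏ j ∈ Finset.Ioi i, (X i - X j)) *
      ∏ p : Fin n × Fin n with p.1 ≤ p.2, (1 + X p.1 + X p.2) := by
  have hentry : (Matrix.of fun i k : Fin n => (1 + 2 * X k : MvPolynomial (Fin n) ℚ) ^
      (staircaseFull n i + (n - 1 - (i : ℕ)))) =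
      Matrix.of fun i k : Fin n => (1 + 2 * X k) *
        (Matrix.of fun i k : Fin n =>
          ((1 + 2 * X k : MvPolynomial (Fin n) ℚ) ^ 2) ^ (n - 1 - (i : ℕ))) i k := by
    ext1 i k
    simp only [Matrix.of_apply, staircaseFull]
    rw [← pow_mul, ← pow_succ']
    congr 1
    omega
  rw [hentry, Matrix.det_mul_row, det_pow_rev_eq_prod_sub]
  have hfour : ∏ i : Fin n, ∏ j ∈ Finset.Ioi i, (4 : MvPolynomial (Fin n) ℚ) =
      4 ^ n.choose 2 := by
    simp only [Finset.prod_const, Fin.card_Ioi]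
    rw [Finset.prod_pow_eq_pow_sum, sum_sub_val_eq_choose_two]
  have hprod : ∏ p : Fin n × Fin n with p.1 ≤ p.2, (1 + X p.1 + X p.2 : MvPolynomial (Fin n) ℚ) =
      (∏ i : Fin n, (1 + 2 * X i)) * ∏ i : Fin n, ∏ j ∈ Finset.Ioi i, (1 + X i + X j) := by
    rw [Finset.prod_finset_product _ Finset.univ (fun i => Finset.Ici i) (by simp),
      ← Finset.prod_mul_distrib]
    refine Finset.prod_congr rfl fun i _ => ?_
    rw [← Finset.Ioi_insert, Finset.prod_insert (by simp)]
    ring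
  rw [← hfour, hprod]
  have hdiff : ∏ i : Fin n, ∏ j ∈ Finset.Ioi i,
      ((1 + 2 * X i) ^ 2 - (1 + 2 * X j) ^ 2 : MvPolynomial (Fin n) ℚ) =
      (∏ i : Fin n, ∏ j ∈ Finset.Ioi i, 4) * (∏ i : Fin n, ∏ j ∈ Finset.Ioi i, (X i - X j)) *
        ∏ i : Fin n, ∏ j ∈ Finset.Ioi i, (1 + X i + X j) := by
    simp only [← Finset.prod_mul_distrib]
    refine Finset.prod_congr rfl fun i _ => Finset.prod_congr rfl fun j _ => ?_
    ring
  rw [hdiff]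
  ring

open scoped Classical in
theorem det_binomial_expansion (n : ℕ) :
    (Matrix.of fun i k : Fin n => (1 + 2 * X k : MvPolynomial (Fin n) ℚ) ^
      (staircaseFull n i + (n - 1 - (i : ℕ)))).det =
    ∑ mu ∈ (Finset.Iic (staircaseFull n)).filter (fun mu => Antitone mu),
      (binomDet n (staircaseFull n) mu : MvPolynomial (Fin n) ℚ) *
        2 ^ (∑ i, mu i + n.choose 2) *
        (schur n mu * ∏ i : Fin n, ∏ j ∈ Finset.Ioi i, (X i - X j)) := by
  let A : Matrix (Fin n) (Fin (2 * n))ᵒᵈ (MvPolynomial (Fin n) ℚ) := Matrix.of fun i m =>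
    2 ^ (OrderDual.ofDual m).val *
      ((staircaseFull n i + (n - 1 - (i : ℕ))).choose (OrderDual.ofDual m).val :
        MvPolynomial (Fin n) ℚ)
  let B : Matrix (Fin (2 * n))ᵒᵈ (Fin n) (MvPolynomial (Fin n) ℚ) := Matrix.of fun m k =>
    X k ^ (OrderDual.ofDual m).val
  have hAB : (Matrix.of fun i k : Fin n => (1 + 2 * X k : MvPolynomial (Fin n) ℚ) ^
      (staircaseFull n i + (n - 1 - (i : ℕ)))) = A * B := by
    ext1 i k
    rw [Matrix.mul_apply, Matrix.of_apply, add_comm, add_pow]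
    simp only [A, B, Matrix.of_apply, one_pow, mul_one]
    set a := staircaseFull n i + (n - 1 - (i : ℕ)) with ha
    have ha' : a + 1 ≤ 2 * n := by simp only [ha, staircaseFull]; omega
    rw [← Equiv.sum_comp OrderDual.toDual]
    simp only [OrderDual.ofDual_toDual]
    rw [Fin.sum_univ_eq_sum_range 
      (fun m => (2 ^ m * (a.choose m : MvPolynomial (Fin n) ℚ)) * X k ^ m)]
    rw [← Finset.sum_subset (Finset.range_subset_range.2 ha')]
    · refine Finset.sum_congr rfl fun m _ => by ring
    · intro m _ hm
      rw [Finset.mem_range] at hm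
      rw [Nat.choose_eq_zero_of_lt (by omega)]
      simp
  rw [hAB, Matrix.det_mul_eq_sum_strictMono]
  have hterm (f : Fin n → (Fin (2 * n))ᵒᵈ) (mu : Fin n → ℕ)
      (hf : ∀ j, (OrderDual.ofDual (f j)).val = mu j + (n - 1 - (j : ℕ))) :
      (A.submatrix id f).det * (B.submatrix f id).det =
      (binomDet n (staircaseFull n) mu : MvPolynomial (Fin n) ℚ) *
        2 ^ (∑ i, mu i + n.choose 2) *
        (schur n mu * ∏ i : Fin n, ∏ j ∈ Finset.Ioi i, (X i - X j)) := by
    rw [← det_X_pow_eq_schur_mul]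
    congr 1
    · have : A.submatrix id f = Matrix.of fun i j => 2 ^ (mu j + (n - 1 - (j : ℕ))) *
        ((Matrix.of fun i j : Fin n => ((staircaseFull n i + (n - 1 - (i : ℕ))).choose
          (mu j + (n - 1 - (j : ℕ))) : ℤ)).map
            (Int.castRingHom (MvPolynomial (Fin n) ℚ))) i j := by
        ext1 i j
        simp [A, hf]
      rw [this, Matrix.det_mul_row, Finset.prod_pow_eq_pow_sum, Finset.sum_add_distrib,
        sum_sub_val_eq_choose_two, mul_comm, binomDet, ← RingHom.mapMatrix_apply, ← RingHom.map_det]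
      rfl
    · congr 1
      ext1 j k
      simp [B, hf]
  have hanti {f : Fin n → (Fin (2 * n))ᵒᵈ} (hf : StrictMono f) :
      StrictAnti fun j => (OrderDual.ofDual (f j)).val := fun i j hij => hf hij
  have hlow {f : Fin n → (Fin (2 * n))ᵒᵈ} (hf : StrictMono f) (j : Fin n) :
      (OrderDual.ofDual (f j)).val =
        ((OrderDual.ofDual (f j)).val - (n - 1 - (j : ℕ))) + (n - 1 - (j : ℕ)) := by
    have hj := j.isLt
    have := StrictAnti.add_val_le (hanti hf) (i := j) (j := ⟨n - 1, by omega⟩)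
      (Fin.le_def.2 (by simp; omega))
    simp only at this
    omega
  have hmu {f : Fin n → (Fin (2 * n))ᵒᵈ} (hf : StrictMono f) :
      Antitone fun j => (OrderDual.ofDual (f j)).val - (n - 1 - (j : ℕ)) := by
    intro i j hij
    have := StrictAnti.add_val_le (hanti hf) hij
    have := hlow hf i
    have := hlow hf j
    have := Fin.le_def.1 hij
    simp only at *
    omega
  refine Finset.sum_bij_ne_zero
    (fun f _ _ j => (OrderDual.ofDual (f j)).val - (n - 1 - (j : ℕ))) ?_ ?_ ?_ ?_
  · intro f hf h0
    rw [Finset.mem_filter] at hf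
    rw [Finset.mem_filter, Finset.mem_Iic]
    refine ⟨?_, hmu hf.2⟩
    by_contra hle
    rw [hterm f _ (hlow hf.2), binomDet_eq_zero_of_not_le _ (hmu hf.2) hle] at h0
    · simp at h0
    · intro i j hij
      exact Nat.sub_le_sub_left hij n
  · intro f hf _ g hg _ h
    rw [Finset.mem_filter] at hf hg
    ext1 j
    have h1 := congrFun h j
    have h2 := hlow hf.2 j
    have h3 := hlow hg.2 j
    refine OrderDual.ofDual.injective (Fin.ext ?_)
    omega
  · intro mu hmem h0
    rw [Finset.mem_filter, Finset.mem_Iic] at hmem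
    have hb (j : Fin n) : mu j + (n - 1 - (j : ℕ)) < 2 * n := by
      have := hmem.1 j
      have := j.isLt
      simp only [staircaseFull] at *
      omega
    let f : Fin n → (Fin (2 * n))ᵒᵈ := fun j => OrderDual.toDual ⟨mu j + (n - 1 - (j : ℕ)), hb j⟩
    refine ⟨f, ?_, ?_, ?_⟩
    · rw [Finset.mem_filter]
      refine ⟨Finset.mem_univ _, fun i j hij => ?_⟩
      have := hmem.2 hij.le
      have := Fin.lt_def.1 hij
      change mu j + (n - 1 - (j : ℕ)) < mu i + (n - 1 - (i : ℕ))
      omega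
    · rw [hterm f mu fun j => rfl]
      exact h0
    · ext j
      simp [f]
  · intro f hf _
    rw [Finset.mem_filter] at hf
    exact hterm f _ (hlow hf.2)

open scoped Classical in
theorem stmt4 (n : ℕ) :
    (2 : MvPolynomial (Fin n) ℚ) ^ n.choose 2 *
        ∏ p ∈ (Finset.univ : Finset (Fin n × Fin n)).filter (fun p => p.1 ≤ p.2),
          (1 + X p.1 + X p.2) =
      ∑ mu ∈ (Finset.Iic (staircaseFull n)).filter (fun mu => Antitone mu),
        (binomDet n (staircaseFull n) mu : MvPolynomial (Fin n) ℚ) * 2 ^ (∑ i, mu i) *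
          schur n mu := by
  have hV : (∏ i : Fin n, ∏ j ∈ Finset.Ioi i, (X i - X j : MvPolynomial (Fin n) ℚ)) ≠ 0 := by
    refine Finset.prod_ne_zero_iff.2 fun i _ => Finset.prod_ne_zero_iff.2 fun j hj => ?_
    rw [sub_ne_zero]
    exact fun h => (Finset.mem_Ioi.1 hj).ne (X_injective h)
  have h2 : (2 : MvPolynomial (Fin n) ℚ) ^ n.choose 2 ≠ 0 := pow_ne_zero _ two_ne_zero
  refine mul_left_cancel₀ (mul_ne_zero h2 hV) ?_
  have h := (det_odd_powers n).symm.trans (det_binomial_expansion n)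
  have h4 : (4 : MvPolynomial (Fin n) ℚ) ^ n.choose 2 = 2 ^ n.choose 2 * 2 ^ n.choose 2 := by
    rw [← mul_pow]; norm_num
  rw [h4] at h
  rw [mul_mul_mul_comm, ← mul_assoc, h, Finset.mul_sum]
  refine Finset.sum_congr rfl fun mu _ => ?_
  ring
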